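/- Let P_S and P_T be joint distributions on 𝒵 × 𝒴, let P_{S+T} = (1/2)(P_S + P_T), and let F' : 𝒵 → 𝒴 be a classifier such that P_{S+T}(F'(z)|z) > 0 for every z with P_{S+T}(z) > 0. Then ε_{P_S}(F') + ε_{P_T}(F') ≤ −4·Σ_{z : P_{S+T}(z)>0} P_{S+T}(z)·log P_{S+T}(F'(z)|z). -/

import Mathlib

open Finset

/-- Marginal on `Z` of a joint pmf on `Z × Y`. -/
noncomputable def margZ {Z Y : Type*} [Fintype Y] (P : Z × Y → ℝ) (z : Z) : ℝ :=
  ∑ y, P (z, y)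

/-- Marginal on `Y` of a joint pmf on `Z × Y`. -/
noncomputable def margY {Z Y : Type*} [Fintype Z] (P : Z × Y → ℝ) (y : Y) : ℝ :=
  ∑ z, P (z, y)

/-- Expected risk `ε_P(F) = ∑_{z : P(z)>0} P(z) ∑_y |1[y = F z] − P(y|z)|`. -/
noncomputable def risk {Z Y : Type*} [Fintype Z] [Fintype Y] [DecidableEq Y]
    (P : Z × Y → ℝ) (F : Z → Y) : ℝ :=
  ∑ z ∈ Finset.univ.filter (fun z => 0 < margZ P z),
    margZ P z * ∑ y, |(if y = F z then (1 : ℝ) else 0) - P (z, y) / margZ P z|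

/-- Disagreement of two classifiers w.r.t. a distribution on `Z`. -/
noncomputable def disag {Z : Type*} (Y : Type*) [Fintype Z] [Fintype Y] [DecidableEq Y]
    (Pz : Z → ℝ) (F₁ F₂ : Z → Y) : ℝ :=
  ∑ z, Pz z * ∑ y, |(if y = F₁ z then (1 : ℝ) else 0) - (if y = F₂ z then (1 : ℝ) else 0)|

/-- `HΔH`-divergence over the hypothesis class of all functions `Z → Y`. -/
noncomputable def dHH {Z : Type*} (Y : Type*) [Fintype Z] [Fintype Y] [DecidableEq Y]
    (P₁ P₂ : Z → ℝ) : ℝ :=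
  2 * ⨆ F₁ : Z → Y, ⨆ F₂ : Z → Y, |disag Y P₁ F₁ F₂ - disag Y P₂ F₁ F₂|

/-- Mutual information of a joint pmf on `A × B` (natural log). -/
noncomputable def MI {A B : Type*} [Fintype A] [Fintype B] (P : A × B → ℝ) : ℝ :=
  ∑ p ∈ Finset.univ.filter (fun p => 0 < P p),
    P p * Real.log (P p / ((∑ b, P (p.1, b)) * (∑ a, P (a, p.2))))

/-- Entropy of the `Y`-marginal (natural log, `0 log 0 = 0`). -/
noncomputable def entY {Z Y : Type*} [Fintype Z] [Fintype Y] (P : Z × Y → ℝ) : ℝ :=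
  -∑ y, margY P y * Real.log (margY P y)

/-- Conditionally-i.i.d. pair distribution `P⊗(z₁,z₂) = ∑_{y : P(y)>0} P(y) P(z₁|y) P(z₂|y)`. -/
noncomputable def pairDist {Z Y : Type*} [Fintype Z] [Fintype Y] (P : Z × Y → ℝ) :
    Z × Z → ℝ := fun p =>
  ∑ y ∈ Finset.univ.filter (fun y => 0 < margY P y),
    margY P y * (P (p.1, y) / margY P y) * (P (p.2, y) / margY P y)

/-- Kullback–Leibler divergence of finite pmfs (natural log). -/
noncomputable def KL {X : Type*} [Fintype X] (p q : X → ℝ) : ℝ :=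
  ∑ x ∈ Finset.univ.filter (fun x => 0 < p x), p x * Real.log (p x / q x)

theorem sum_abs_indicator_sub_cond {Z Y : Type*} [Fintype Y] [DecidableEq Y]
    {P : Z × Y → ℝ} (hP : ∀ p, 0 ≤ P p) (F : Z → Y) {z : Z} (hz : 0 < margZ P z) :
    margZ P z * ∑ y, |(if y = F z then (1 : ℝ) else 0) - P (z, y) / margZ P z|
      = 2 * (margZ P z - P (z, F z)) := by
  have hle : P (z, F z) ≤ margZ P z :=
    Finset.single_le_sum (f := fun y => P (z, y)) (fun y _ => hP _) (Finset.mem_univ (F z))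
  have hterm : ∀ y, margZ P z * |(if y = F z then (1 : ℝ) else 0) - P (z, y) / margZ P z|
      = P (z, y) + if y = F z then margZ P z - 2 * P (z, F z) else 0 := by
    intro y
    rw [← abs_of_pos hz, ← abs_mul, abs_of_pos hz, mul_sub, mul_div_cancel₀ _ hz.ne']
    split_ifs with h
    · subst h
      rw [mul_one, abs_of_nonneg (sub_nonneg.2 hle)]
      ring
    · rw [mul_zero, zero_sub, abs_neg, abs_of_nonneg (hP _), add_zero]
  rw [Finset.mul_sum, Finset.sum_congr rfl fun y _ => hterm y, Finset.sum_add_distrib,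
    Finset.sum_ite_eq' Finset.univ, if_pos (Finset.mem_univ _)]
  change margZ P z + _ = _
  ring

theorem risk_eq_sum {Z Y : Type*} [Fintype Z] [Fintype Y] [DecidableEq Y]
    {P : Z × Y → ℝ} (hP : ∀ p, 0 ≤ P p) (F : Z → Y) :
    risk P F = ∑ z, 2 * (margZ P z - P (z, F z)) := by
  unfold risk
  rw [Finset.sum_filter]
  refine Finset.sum_congr rfl fun z _ => ?_
  split_ifs with hz
  · exact sum_abs_indicator_sub_cond hP F hz
  · have hle : P (z, F z) ≤ margZ P z :=
      Finset.single_le_sum (f := fun y => P (z, y)) (fun y _ => hP _) (Finset.mem_univ (F z))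
    have := hP (z, F z)
    linarith

theorem margZ_half_add {Z Y : Type*} [Fintype Y] (P Q : Z × Y → ℝ) (z : Z) :
    margZ (fun p => (1 / 2) * (P p + Q p)) z = (1 / 2) * (margZ P z + margZ Q z) := by
  simp only [margZ, ← Finset.mul_sum, Finset.sum_add_distrib]

theorem sum_risks_log_bound {Z Y : Type*} [Fintype Z] [Fintype Y] [Nonempty Z] [Nonempty Y]
    [DecidableEq Y]
    (PS PT : Z × Y → ℝ)
    (hS0 : ∀ p, 0 ≤ PS p) (hS1 : ∑ p, PS p = 1)
    (hT0 : ∀ p, 0 ≤ PT p) (hT1 : ∑ p, PT p = 1)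
    (F' : Z → Y)
    (hpos : ∀ z, 0 < margZ (fun p => (1 / 2) * (PS p + PT p)) z →
      0 < (1 / 2) * (PS (z, F' z) + PT (z, F' z)) /
            margZ (fun p => (1 / 2) * (PS p + PT p)) z) :
    risk PS F' + risk PT F'
      ≤ -4 * ∑ z ∈ Finset.univ.filter
            (fun z => 0 < margZ (fun p => (1 / 2) * (PS p + PT p)) z),
          margZ (fun p => (1 / 2) * (PS p + PT p)) z *
            Real.log ((1 / 2) * (PS (z, F' z) + PT (z, F' z)) /
              margZ (fun p => (1 / 2) * (PS p + PT p)) z) := by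
  rw [risk_eq_sum hS0, risk_eq_sum hT0, ← Finset.sum_add_distrib, Finset.sum_filter,
    Finset.mul_sum]
  refine Finset.sum_le_sum fun z _ => ?_
  have hm := margZ_half_add PS PT z
  have hq := hpos z
  generalize margZ (fun p => (1 / 2) * (PS p + PT p)) z = m at hm hq ⊢
  split_ifs with hz
  · have hlog := mul_le_mul_of_nonneg_left (Real.log_le_sub_one_of_pos (hq hz)) hz.le
    rw [mul_sub, mul_div_cancel₀ _ hz.ne'] at hlog
    linarith
  · have := hS0 (z, F' z)
    have := hT0 (z, F' z)
    linarith
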